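/- Let n ≥ 1 and let B be an invertible (n+1)×(n+1) complex matrix whose induced projective transformation maps the Veronese curve 𝒞ₙ onto itself; concretely, assume that for every nonzero v ∈ ℂ² there is a nonzero w ∈ ℂ² with B·Ψₙ(v) proportional to Ψₙ(w), and for every nonzero w ∈ ℂ² there is a nonzero v ∈ ℂ² with B·Ψₙ(v) proportional to Ψₙ(w). Then there exist an invertible 2×2 complex matrix A and a nonzero scalar λ ∈ ℂ such that B = λ·ϱₙ(A). (The group of projective automorphisms of 𝒞ₙ is ϱₙ(PSL(2,ℂ)).) -/

import Mathlib

open Matrix Filter Topology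

/-- The Veronese lift `Ψₙ : ℂ² → ℂ^{n+1}`, whose `k`-th coordinate at `(x, y)` is
`C(n,k) · x^(n-k) · y^k`. -/
noncomputable def veronese (n : ℕ) (v : Fin 2 → ℂ) : Fin (n + 1) → ℂ :=
  fun k => (n.choose (k : ℕ) : ℂ) * v 0 ^ (n - (k : ℕ)) * v 1 ^ (k : ℕ)

/-- The matrix `ϱₙ(A)`: the n-th symmetric power of the 2×2 matrix `A` written in the
Veronese basis, given by the explicit entry formula. -/
noncomputable def rho (n : ℕ) (A : Matrix (Fin 2) (Fin 2) ℂ) :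
    Matrix (Fin (n + 1)) (Fin (n + 1)) ℂ :=
  fun m j =>
    ((n.choose (m : ℕ) : ℂ) / (n.choose (j : ℕ) : ℂ)) *
      ∑ l ∈ Finset.Icc ((j : ℕ) - (n - (m : ℕ))) (min (j : ℕ) (m : ℕ)),
        (((n - (m : ℕ)).choose ((j : ℕ) - l) : ℂ) * (((m : ℕ).choose l : ℕ) : ℂ)) *
          A 0 0 ^ (n - (m : ℕ) - ((j : ℕ) - l)) * A 0 1 ^ ((j : ℕ) - l) *
          A 1 0 ^ ((m : ℕ) - l) * A 1 1 ^ l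

open Polynomial in
/-- The polynomial in `t` given by the `m`-th coordinate of `M *ᵥ veronese n (1, t)`. -/
noncomputable def rowPolynomial {n : ℕ} (M : Matrix (Fin (n + 1)) (Fin (n + 1)) ℂ)
    (m : Fin (n + 1)) : ℂ[X] :=
  ∑ j : Fin (n + 1), C (M m j * (n.choose j : ℂ)) * X ^ (j : ℕ)

section RowPolynomial

open Polynomial

variable {n : ℕ} (M : Matrix (Fin (n + 1)) (Fin (n + 1)) ℂ)

theorem eval_rowPolynomial (m : Fin (n + 1)) (t : ℂ) :
    (rowPolynomial M m).eval t = (M *ᵥ veronese n ![1, t]) m := by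
  simp [rowPolynomial, eval_finsetSum, Matrix.mulVec, dotProduct, veronese, mul_assoc]

theorem coeff_rowPolynomial (m j : Fin (n + 1)) :
    (rowPolynomial M m).coeff j = M m j * (n.choose j : ℂ) := by
  simp only [rowPolynomial, finsetSum_coeff, coeff_C_mul_X_pow, Fin.val_inj,
    Finset.sum_ite_eq, Finset.mem_univ, if_true]

theorem natDegree_rowPolynomial_le (m : Fin (n + 1)) : (rowPolynomial M m).natDegree ≤ n :=
  natDegree_sum_le_of_forall_le _ _ fun j _ =>
    (natDegree_C_mul_X_pow_le _ _).trans (Nat.le_of_lt_succ j.2)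

theorem choose_cast_ne_zero (m : Fin (n + 1)) : (n.choose m : ℂ) ≠ 0 :=
  Nat.cast_ne_zero.2 (Nat.choose_pos (Nat.le_of_lt_succ m.2)).ne'

theorem rowPolynomial_eq_zero_iff (m : Fin (n + 1)) : rowPolynomial M m = 0 ↔ M m = 0 := by
  refine ⟨fun h => funext fun j => ?_, fun h => by simp [rowPolynomial, h]⟩
  have := coeff_rowPolynomial M m j
  rw [h, coeff_zero] at this
  exact (mul_eq_zero.1 this.symm).resolve_right (choose_cast_ne_zero j)

theorem sum_inv_mul_rowPolynomial (hM : IsUnit M) :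
    ∑ m, C (M⁻¹ 0 m) * rowPolynomial M m = 1 := by
  have hinv : M⁻¹ * M = 1 := Matrix.nonsing_inv_mul M ((Matrix.isUnit_iff_isUnit_det M).1 hM)
  refine Polynomial.funext fun t => ?_
  simp only [eval_finsetSum, eval_mul, eval_C, eval_rowPolynomial, eval_one]
  calc ∑ m, M⁻¹ 0 m * (M *ᵥ veronese n ![1, t]) m
      = (M⁻¹ *ᵥ (M *ᵥ veronese n ![1, t])) 0 := rfl
    _ = 1 := by simp [Matrix.mulVec_mulVec, hinv, veronese]

theorem matrix_ext_of_mulVec_veronese {M N : Matrix (Fin (n + 1)) (Fin (n + 1)) ℂ}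
    (h : ∀ t : ℂ, M *ᵥ veronese n ![1, t] = N *ᵥ veronese n ![1, t]) : M = N := by
  ext m j
  have hp : rowPolynomial M m = rowPolynomial N m :=
    Polynomial.funext fun t => by simp only [eval_rowPolynomial, h]
  refine mul_right_cancel₀ (choose_cast_ne_zero j) ?_
  rw [← coeff_rowPolynomial, ← coeff_rowPolynomial, hp]

end RowPolynomial

theorem veronese_ne_zero (n : ℕ) {v : Fin 2 → ℂ} (hv : v ≠ 0) : veronese n v ≠ 0 := by
  intro h
  refine hv ?_
  have h0 : v 0 ^ n = 0 := by simpa [veronese] using congrFun h 0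
  have h1 : v 1 ^ n = 0 := by simpa [veronese] using congrFun h (Fin.last n)
  ext i
  fin_cases i
  · exact eq_zero_of_pow_eq_zero h0
  · exact eq_zero_of_pow_eq_zero h1

theorem veronese_zero {n : ℕ} (hn : 1 ≤ n) : veronese n 0 = 0 := by
  ext k
  rcases Nat.eq_zero_or_pos (k : ℕ) with hk | hk
  · simp [veronese, hk, Nat.one_le_iff_ne_zero.1 hn]
  · simp [veronese, hk.ne']

/-- The symmetric power `ϱₙ(A)` intertwines the Veronese lift with the action of `A`. -/
theorem rho_mulVec_veronese (n : ℕ) (A : Matrix (Fin 2) (Fin 2) ℂ) (v : Fin 2 → ℂ) :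
    rho n A *ᵥ veronese n v = veronese n (A *ᵥ v) := by
  ext m
  obtain ⟨m, hm⟩ := m
  have key : ∑ j ∈ Finset.range (n + 1), ∑ l ∈ Finset.Icc (j - (n - m)) (min j m),
      (((n - m).choose (j - l) : ℂ) * (m.choose l : ℂ)) *
        A 0 0 ^ (n - m - (j - l)) * A 0 1 ^ (j - l) * A 1 0 ^ (m - l) * A 1 1 ^ l *
          (v 0 ^ (n - j) * v 1 ^ j) =
      (A 0 1 * v 1 + A 0 0 * v 0) ^ (n - m) * (A 1 1 * v 1 + A 1 0 * v 0) ^ m := by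
    rw [add_pow, add_pow, Finset.sum_mul_sum, Finset.sum_sigma', Finset.sum_sigma']
    refine Finset.sum_nbij' (fun p => ⟨p.1 - p.2, p.2⟩) (fun p => ⟨p.1 + p.2, p.2⟩) ?_ ?_ ?_ ?_ ?_
    · rintro ⟨j, l⟩ h
      simp only [Finset.mem_sigma, Finset.mem_range, Finset.mem_Icc] at h ⊢
      omega
    · rintro ⟨i, l⟩ h
      simp only [Finset.mem_sigma, Finset.mem_range, Finset.mem_Icc] at h ⊢
      omega
    · rintro ⟨j, l⟩ h
      simp only [Finset.mem_sigma, Finset.mem_range, Finset.mem_Icc] at h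
      simp only [Sigma.mk.injEq, heq_eq_eq, and_true]
      omega
    · rintro ⟨i, l⟩ _
      simp
    · rintro ⟨j, l⟩ h
      simp only [Finset.mem_sigma, Finset.mem_range, Finset.mem_Icc] at h
      obtain ⟨i, rfl⟩ : ∃ i, j = i + l := ⟨j - l, by omega⟩
      have hx : n - (i + l) = (n - m - i) + (m - l) := by omega
      simp only [Nat.add_sub_cancel, hx, mul_pow, pow_add]
      ring
  have hA : ∀ i, (A *ᵥ v) i = A i 1 * v 1 + A i 0 * v 0 := fun i => by
    simp [Matrix.mulVec, dotProduct, Fin.sum_univ_two, add_comm]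
  simp only [veronese, hA, mul_assoc (n.choose m : ℂ)]
  rw [← key, Finset.sum_range, Finset.mul_sum, Matrix.mulVec, dotProduct]
  refine Finset.sum_congr rfl fun j _ => ?_
  have hj := choose_cast_ne_zero j
  simp only [rho, veronese, ← Finset.sum_mul]
  field_simp

/-- A finite sequence in which every entry is `p 0 * (p 1 / p 0) ^ m` has a common factor
`h` and otherwise consists of the degree-`n` monomials in two elements. -/
theorem exists_eq_mul_pow_mul_pow {R : Type*} [EuclideanDomain R] {n : ℕ} (p : ℕ → R)
    (hp0 : p 0 ≠ 0) (hp : ∀ m ≤ n, p m * p 0 ^ m = p 0 * p 1 ^ m) :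
    ∃ a b h : R, ∀ m ≤ n, p m = h * a ^ (n - m) * b ^ m := by
  classical
  obtain ⟨a, ha⟩ := EuclideanDomain.gcd_dvd_left (p 0) (p 1)
  obtain ⟨b, hb⟩ := EuclideanDomain.gcd_dvd_right (p 0) (p 1)
  set g := EuclideanDomain.gcd (p 0) (p 1)
  have hg0 : g ≠ 0 := fun h => hp0 (by rw [ha, h, zero_mul])
  have ha0 : a ≠ 0 := fun h => hp0 (by rw [ha, h, mul_zero])
  have hab : IsCoprime a b := by
    obtain ⟨x, y, hxy⟩ : ∃ x y, g = p 0 * x + p 1 * y := ⟨_, _, EuclideanDomain.gcd_eq_gcd_ab _ _⟩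
    refine ⟨x, y, mul_left_cancel₀ hg0 ?_⟩
    calc g * (x * a + y * b) = g * a * x + g * b * y := by ring
      _ = g * 1 := by rw [← ha, ← hb, ← hxy, mul_one]
  have hpm : ∀ m ≤ n, p m * a ^ m = p 0 * b ^ m := fun m hm => by
    refine mul_left_cancel₀ (pow_ne_zero m hg0) ?_
    calc g ^ m * (p m * a ^ m) = p m * (g * a) ^ m := by ring
      _ = p 0 * (g * b) ^ m := by rw [← ha, ← hb, hp m hm]
      _ = g ^ m * (p 0 * b ^ m) := by ring
  obtain ⟨h, hh⟩ : a ^ n ∣ p 0 :=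
    (hab.pow : IsCoprime (a ^ n) (b ^ n)).dvd_of_dvd_mul_right
      ⟨p n, by rw [← hpm n le_rfl, mul_comm]⟩
  refine ⟨a, b, h, fun m hm => mul_right_cancel₀ (pow_ne_zero m ha0) ?_⟩
  rw [hpm m hm, hh, ← Nat.sub_add_cancel hm, pow_add, Nat.add_sub_cancel]
  ring

/-- Any invertible `(n+1)×(n+1)` matrix whose projective action preserves the Veronese curve
is, up to a nonzero scalar, of the form `ϱₙ(A)` for an invertible 2×2 matrix `A`: the group
of projective automorphisms of the Veronese curve is `ϱₙ(PSL(2,ℂ))`. -/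
theorem veronese_curve_automorphisms (n : ℕ) (hn : 1 ≤ n)
    (B : Matrix (Fin (n + 1)) (Fin (n + 1)) ℂ) (hB : IsUnit B)
    (h1 : ∀ v : Fin 2 → ℂ, v ≠ 0 → ∃ w : Fin 2 → ℂ, w ≠ 0 ∧ ∃ c : ℂ,
      B *ᵥ veronese n v = c • veronese n w)
    (h2 : ∀ w : Fin 2 → ℂ, w ≠ 0 → ∃ v : Fin 2 → ℂ, v ≠ 0 ∧ ∃ c : ℂ,
      B *ᵥ veronese n v = c • veronese n w) :
    ∃ A : Matrix (Fin 2) (Fin 2) ℂ, IsUnit A ∧ ∃ lam : ℂ, lam ≠ 0 ∧ B = lam • rho n A := by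
  have hB0 : ∀ x, B *ᵥ x = 0 → x = 0 := fun x hx =>
    Matrix.mulVec_injective_of_isUnit hB (hx.trans (Matrix.mulVec_zero B).symm)
  let p : ℕ → Polynomial ℂ := fun m =>
    if hm : m < n + 1 then
      Polynomial.C (n.choose m : ℂ)⁻¹ * rowPolynomial B ⟨m, hm⟩ else 0
  have hpB : ∀ m : Fin (n + 1), rowPolynomial B m = Polynomial.C (n.choose m : ℂ) * p m :=
    fun m => by
      simp only [p, m.2, dif_pos, ← mul_assoc, ← Polynomial.C_mul,
        mul_inv_cancel₀ (choose_cast_ne_zero m), Polynomial.C_1, one_mul, Fin.eta]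
  have hdeg : ∀ m, (p m).natDegree ≤ n := fun m => by
    by_cases hm : m < n + 1
    · simp only [p, hm, dif_pos]
      exact (Polynomial.natDegree_C_mul_le _ _).trans (natDegree_rowPolynomial_le B _)
    · simp only [p, hm, dif_neg, not_false_eq_true, Polynomial.natDegree_zero, Nat.zero_le]
  have hp0 : p 0 ≠ 0 := fun h => by
    have hrow : B 0 = 0 := (rowPolynomial_eq_zero_iff B 0).1 (by rw [hpB]; simp [h])
    exact ((Matrix.isUnit_iff_isUnit_det B).1 hB).ne_zero
      (Matrix.det_eq_zero_of_row_eq_zero 0 fun j => congrFun hrow j)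
  have hpoint : ∀ t : ℂ, ∃ (c : ℂ) (w : Fin 2 → ℂ), ∀ m ≤ n,
      (p m).eval t = c * w 0 ^ (n - m) * w 1 ^ m := fun t => by
    obtain ⟨w, -, c, hw⟩ := h1 ![1, t] fun h => one_ne_zero (congrFun h 0)
    refine ⟨c, w, fun m hm => ?_⟩
    have hm' := Nat.lt_succ_of_le hm
    have hc := choose_cast_ne_zero (⟨m, hm'⟩ : Fin (n + 1))
    refine mul_left_cancel₀ hc ?_
    have he := eval_rowPolynomial B ⟨m, hm'⟩ t
    rw [hpB, hw, Polynomial.eval_mul, Polynomial.eval_C] at he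
    rw [he]
    simp only [Pi.smul_apply, smul_eq_mul, veronese]
    ring
  obtain ⟨a, b, h, habh⟩ := exists_eq_mul_pow_mul_pow (n := n) p hp0 fun m hm =>
    Polynomial.funext fun t => by
      obtain ⟨c, w, hw⟩ := hpoint t
      simp only [Polynomial.eval_mul, Polynomial.eval_pow, hw m hm, hw 0 (Nat.zero_le n), hw 1 hn]
      obtain ⟨k, rfl⟩ := Nat.exists_eq_add_of_le hm
      obtain ⟨r, hr⟩ := Nat.exists_eq_add_of_le hn
      have hk : m + k - m = k := by omega
      have h1r : m + k - 1 = r := by omega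
      rw [hk, h1r, Nat.sub_zero, hr]
      have : w 0 ^ k * w 0 ^ m = w 0 ^ r * w 0 := by rw [← pow_add, ← pow_succ]; congr 1; omega
      simp only [mul_pow, pow_add, pow_one, pow_zero, mul_one]
      linear_combination c * c ^ m * w 1 ^ m * (w 0 ^ r) ^ m * this
  have hunit : IsUnit h := isUnit_of_dvd_one <| by
    rw [← sum_inv_mul_rowPolynomial B hB]
    refine Finset.dvd_sum fun m _ => ?_
    rw [hpB, habh m (Nat.le_of_lt_succ m.2)]
    exact ⟨Polynomial.C (B⁻¹ 0 m) * Polynomial.C (n.choose m : ℂ) * a ^ (n - (m : ℕ)) *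
      b ^ (m : ℕ), by ring⟩
  obtain ⟨lam, hlam, rfl⟩ := Polynomial.isUnit_iff.1 hunit
  have hdeg_le_one : ∀ q : Polynomial ℂ, (Polynomial.C lam * q ^ n).natDegree ≤ n →
      q.natDegree ≤ 1 := fun q hq => by
    rw [Polynomial.natDegree_C_mul hlam.ne_zero, Polynomial.natDegree_pow] at hq
    exact Nat.le_of_mul_le_mul_left (by simpa using hq) hn
  have ha := hdeg_le_one a (by simpa [habh 0 (Nat.zero_le n)] using hdeg 0)
  have hb := hdeg_le_one b (by simpa [habh n le_rfl] using hdeg n)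
  have heval : ∀ q : Polynomial ℂ, q.natDegree ≤ 1 → ∀ t,
      q.eval t = q.coeff 0 + q.coeff 1 * t := fun q hq t => by
    conv_lhs => rw [Polynomial.eq_X_add_C_of_natDegree_le_one hq]
    simp [add_comm]
  set A : Matrix (Fin 2) (Fin 2) ℂ := !![a.coeff 0, a.coeff 1; b.coeff 0, b.coeff 1] with hA
  have hBA : B = lam • rho n A := matrix_ext_of_mulVec_veronese fun t => by
    ext m
    rw [Matrix.smul_mulVec, rho_mulVec_veronese, ← eval_rowPolynomial, hpB,
      habh m (Nat.le_of_lt_succ m.2)]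
    simp [veronese, hA, heval a ha, heval b hb]
    ring
  refine ⟨A, ?_, lam, hlam.ne_zero, hBA⟩
  rw [Matrix.isUnit_iff_isUnit_det, isUnit_iff_ne_zero]
  intro hdet
  obtain ⟨v, hv, hAv⟩ := Matrix.exists_mulVec_eq_zero_iff.2 hdet
  refine veronese_ne_zero n hv (hB0 _ ?_)
  rw [hBA, Matrix.smul_mulVec, rho_mulVec_veronese, hAv, veronese_zero hn, smul_zero]
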